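/- arXiv:1808.01596 — 2 statements merged into one kernel-verified Lean document; each statement's English description precedes it below -/
import Mathlib

section
/- For every n ≥ 1, the total number of corners of type A summed over all bargraphs with n cells equals ((n+1)/12 − 2/9)·2^n − (1/9)·(−1)^n (an identity in ℚ; equivalently, 36·g_n = (3n−5)·2^n − 4·(−1)^n where g_n is this total). -/
/-- Number of corners of type A of a bargraph with column heights `L`:
indices `i` (0-based, `i ≤ m-2`) with `L[i] > L[i+1]`. -/
def cornerA (L : List ℕ) : ℕ :=
  ((Finset.range (L.length - 1)).filter (fun i => L.getD (i + 1) 0 < L.getD i 0)).card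

theorem cornerA_cons_cons (a b : ℕ) (L : List ℕ) :
    cornerA (a :: b :: L) = (if b < a then 1 else 0) + cornerA (b :: L) := by
  unfold cornerA
  simp only [Finset.card_filter, List.length_cons, Nat.add_sub_cancel]
  rw [Finset.sum_range_succ']
  rw [add_comm]
  simp only [List.getD_cons_succ, List.getD_cons_zero, zero_add]

theorem cornerA_nil : cornerA [] = 0 := by simp [cornerA]

theorem cornerA_single (a : ℕ) : cornerA [a] = 0 := by simp [cornerA]

def incHead : List ℕ → List ℕ
  | [] => []
  | a :: l => (a + 1) :: l

def incTwo : List ℕ → List ℕ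
  | a :: b :: l => (a + 1) :: (b + 1) :: l
  | l => l

def eqHead : List ℕ → Bool
  | a :: b :: _ => decide (a = b)
  | _ => false

def bgs (n : ℕ) : Finset (List ℕ) :=
  (Finset.univ : Finset (Composition n)).image Composition.blocks

theorem blocks_inj (n : ℕ) : Function.Injective (Composition.blocks : Composition n → List ℕ) :=
  fun _ _ h => Composition.ext h

theorem mem_bgs (n : ℕ) (L : List ℕ) : L ∈ bgs n ↔ (∀ i ∈ L, 0 < i) ∧ L.sum = n := by
  simp only [bgs, Finset.mem_image, Finset.mem_univ, true_and]
  constructor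
  · rintro ⟨c, rfl⟩
    exact ⟨fun i hi => c.blocks_pos hi, c.blocks_sum⟩
  · rintro ⟨h1, h2⟩
    exact ⟨⟨L, fun {i} hi => h1 i hi, h2⟩, rfl⟩

theorem sum_bgs (n : ℕ) : ∑ L ∈ bgs n, cornerA L = ∑ π : Composition n, cornerA π.blocks := by
  rw [bgs, Finset.sum_image (fun _ _ _ _ h => blocks_inj n h)]

theorem card_bgs (n : ℕ) : (bgs n).card = 2 ^ (n - 1) := by
  rw [bgs, Finset.card_image_of_injective _ (blocks_inj n), Finset.card_univ, composition_card]

theorem incHead_inj : Function.Injective incHead := by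
  intro x y h
  cases x <;> cases y <;> simp_all [incHead]

theorem bgs_succ (n : ℕ) :
    bgs (n + 2) = (bgs (n + 1)).image (List.cons 1) ∪ (bgs (n + 1)).image incHead := by
  ext L
  simp only [Finset.mem_union, Finset.mem_image, mem_bgs]
  constructor
  · rintro ⟨h1, h2⟩
    rcases L with _ | ⟨a, l⟩
    · simp at h2
    · simp only [List.mem_cons, forall_eq_or_imp, List.sum_cons] at h1 h2
      by_cases ha : a = 1
      · subst ha
        exact Or.inl ⟨l, ⟨h1.2, by omega⟩, rfl⟩
      · refine Or.inr ⟨(a - 1) :: l, ⟨?_, ?_⟩, ?_⟩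
        · simp only [List.mem_cons, forall_eq_or_imp]
          exact ⟨by omega, h1.2⟩
        · simp only [List.sum_cons]; omega
        · simp only [incHead]; congr 1; omega
  · rintro (⟨l, ⟨h1, h2⟩, rfl⟩ | ⟨l, ⟨h1, h2⟩, rfl⟩)
    · simp only [List.mem_cons, forall_eq_or_imp, List.sum_cons]
      exact ⟨⟨by omega, h1⟩, by omega⟩
    · rcases l with _ | ⟨a, l⟩
      · simp at h2
      · simp only [incHead, List.mem_cons, forall_eq_or_imp, List.sum_cons] at *
        exact ⟨⟨by omega, h1.2⟩, by omega⟩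

theorem bgs_disj (n : ℕ) :
    Disjoint ((bgs (n + 1)).image (List.cons 1)) ((bgs (n + 1)).image incHead) := by
  rw [Finset.disjoint_left]
  intro L hL hL'
  simp only [Finset.mem_image, mem_bgs] at hL hL'
  obtain ⟨l, -, rfl⟩ := hL
  obtain ⟨m, ⟨h1, h2⟩, h⟩ := hL'
  rcases m with _ | ⟨a, m⟩
  · simp at h2
  · have := h1 a (by simp)
    simp only [incHead, List.cons.injEq] at h
    omega

theorem corner_one (L : List ℕ) (h : ∀ i ∈ L, 0 < i) : cornerA (1 :: L) = cornerA L := by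
  rcases L with _ | ⟨b, l⟩
  · simp [cornerA_single, cornerA_nil]
  · have := h b (by simp)
    rw [cornerA_cons_cons, if_neg (by omega), zero_add]

theorem corner_inc (L : List ℕ) :
    cornerA (incHead L) = cornerA L + if eqHead L = true then 1 else 0 := by
  rcases L with _ | ⟨a, _ | ⟨b, l⟩⟩
  · simp [incHead, eqHead]
  · simp [incHead, eqHead, cornerA_single]
  · simp only [incHead, eqHead, cornerA_cons_cons, decide_eq_true_eq]
    split_ifs <;> omega

theorem G_succ (n : ℕ) : ∑ L ∈ bgs (n + 2), cornerA L =
    2 * ∑ L ∈ bgs (n + 1), cornerA L + ((bgs (n + 1)).filter (fun L => eqHead L = true)).card := by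
  rw [bgs_succ, Finset.sum_union (bgs_disj n), Finset.sum_image (by intro x _ y _ h; simpa using h),
    Finset.sum_image (fun _ _ _ _ h => incHead_inj h), Finset.card_filter]
  rw [Finset.sum_congr rfl (fun L hL => corner_one L ((mem_bgs _ _).1 hL).1)]
  simp only [corner_inc, Finset.sum_add_distrib]
  ring

theorem E_set (n : ℕ) : (bgs (n + 2)).filter (fun L => eqHead L = true) =
    (bgs n).image (fun l => 1 :: 1 :: l) ∪
      ((bgs n).filter (fun L => eqHead L = true)).image incTwo := by
  ext L
  simp only [Finset.mem_union, Finset.mem_image, Finset.mem_filter, mem_bgs]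
  constructor
  · rintro ⟨⟨h1, h2⟩, h3⟩
    rcases L with _ | ⟨a, _ | ⟨b, l⟩⟩
    · simp [eqHead] at h3
    · simp [eqHead] at h3
    · simp only [eqHead, decide_eq_true_eq] at h3
      subst h3
      simp only [List.mem_cons, forall_eq_or_imp, List.sum_cons] at h1 h2
      by_cases ha : a = 1
      · subst ha
        exact Or.inl ⟨l, ⟨h1.2.2, by omega⟩, rfl⟩
      · refine Or.inr ⟨(a - 1) :: (a - 1) :: l, ⟨⟨?_, ?_⟩, ?_⟩, ?_⟩
        · simp only [List.mem_cons, forall_eq_or_imp]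
          exact ⟨by omega, by omega, h1.2.2⟩
        · simp only [List.sum_cons]; omega
        · simp [eqHead]
        · have : a - 1 + 1 = a := by omega
          simp only [incTwo, this]
  · rintro (⟨l, ⟨h1, h2⟩, rfl⟩ | ⟨l, ⟨⟨h1, h2⟩, h3⟩, rfl⟩)
    · simp only [List.mem_cons, forall_eq_or_imp, List.sum_cons]
      exact ⟨⟨⟨by omega, by omega, h1⟩, by omega⟩, by simp [eqHead]⟩
    · rcases l with _ | ⟨a, _ | ⟨b, l⟩⟩
      · simp [eqHead] at h3
      · simp [eqHead] at h3
      · simp only [eqHead, decide_eq_true_eq] at h3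
        subst h3
        simp only [incTwo, List.mem_cons, forall_eq_or_imp, List.sum_cons] at *
        exact ⟨⟨⟨by omega, by omega, h1.2.2⟩, by omega⟩, by simp [eqHead]⟩

theorem E_succ (n : ℕ) : ((bgs (n + 2)).filter (fun L => eqHead L = true)).card =
    2 ^ (n - 1) + ((bgs n).filter (fun L => eqHead L = true)).card := by
  rw [E_set, Finset.card_union_of_disjoint, Finset.card_image_of_injective,
    Finset.card_image_of_injOn, card_bgs]
  · intro x hx y hy h
    simp only [Finset.coe_filter, Set.mem_ofPred_eq] at hx hy
    obtain ⟨-, hx⟩ := hx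
    obtain ⟨-, hy⟩ := hy
    rcases x with _ | ⟨a, _ | ⟨b, l⟩⟩ <;> rcases y with _ | ⟨c, _ | ⟨d, m⟩⟩ <;>
      simp_all [eqHead, incTwo]
  · intro x y h
    simpa using h
  · rw [Finset.disjoint_left]
    intro L hL hL'
    simp only [Finset.mem_image, mem_bgs, Finset.mem_filter] at hL hL'
    obtain ⟨l, -, rfl⟩ := hL
    obtain ⟨m, ⟨⟨h1, h2⟩, h3⟩, h⟩ := hL'
    rcases m with _ | ⟨a, _ | ⟨b, m⟩⟩
    · simp [eqHead] at h3
    · simp [eqHead] at h3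
    · have := h1 a (by simp)
      simp only [incTwo, List.cons.injEq] at h
      omega

theorem bgs_zero : bgs 0 = {[]} := by
  ext L
  rw [mem_bgs]
  rcases L with _ | ⟨a, l⟩
  · simp
  · simp; omega

theorem bgs_one : bgs 1 = {[1]} := by
  symm
  apply Finset.eq_of_subset_of_card_le
  · intro L hL
    simp only [Finset.mem_singleton] at hL
    subst hL
    rw [mem_bgs]; simp
  · rw [card_bgs]; simp

/-- Closed form: `6 E(n) = 2^n + 2 (-1)^n` for `n ≥ 1`. -/
theorem E_formula (n : ℕ) :
    (((bgs (n + 1)).filter (fun L => eqHead L = true)).card : ℚ) =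
      (2 ^ (n + 1) + 2 * (-1) ^ (n + 1)) / 6 := by
  induction n using Nat.twoStepInduction with
  | zero => rw [bgs_one, Finset.filter_singleton]; simp [eqHead]
  | one => rw [E_succ, bgs_zero, Finset.filter_singleton]; simp [eqHead]; norm_num
  | more n ih _ =>
    rw [show n + 2 + 1 = n + 1 + 2 by ring, E_succ]
    push_cast
    rw [ih]
    ring

/-- The total number of corners of type A over all bargraphs with `n ≥ 1` cells is
`((n+1)/12 − 2/9)·2^n − (1/9)·(−1)^n`. -/
theorem stmt2 (n : ℕ) (hn : 1 ≤ n) :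
    ((∑ π : Composition n, cornerA π.blocks : ℕ) : ℚ) =
      (((n : ℚ) + 1) / 12 - 2 / 9) * 2 ^ n - (1 / 9) * (-1) ^ n := by
  rw [← sum_bgs]
  obtain ⟨n, rfl⟩ := Nat.exists_eq_add_of_le' hn
  clear hn
  induction n with
  | zero => rw [bgs_one]; simp [cornerA_single]; norm_num
  | succ n ih =>
    rw [G_succ, Nat.cast_add, E_formula, Nat.cast_mul, ih]
    push_cast
    ring
end

section
/- For all n ≥ 0 and k ≥ 1, the total number of corners of type A summed over all set partitions of [n+1] with exactly k blocks equals (n/2)·S(n+1,k) − (1/4)·S(n+2,k) − (n/2)·S(n,k) + (1/4)·S(n+1,k) + (1/4)·S(n,k−2) (an identity in ℚ). -/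
/-- `w` is the canonical word of a set partition: a word over positive
integers with `w 0 = 1` and `w (i+1) ≤ 1 + max(w 0, …, w i)`. -/
def IsCanonicalWord (w : List ℕ) : Prop :=
  (∀ x ∈ w, 0 < x) ∧ (w ≠ [] → w.getD 0 0 = 1) ∧
  ∀ i, i + 1 < w.length → w.getD (i + 1) 0 ≤ 1 + (w.take (i + 1)).foldr max 0

/-- Stirling number of the second kind: the number of set partitions of an
`n`-element set into `k` nonempty blocks. -/
noncomputable def stirling (n k : ℕ) : ℕ :=
  Nat.card {p : Finpartition (Finset.univ : Finset (Fin n)) // p.parts.card = k}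


open Classical in
noncomputable def stmt7Ext {n : ℕ} (x : Σ r : Setoid (Fin n), Option (Quotient r)) :
    Setoid (Fin (n+1)) :=
  Setoid.ker (Fin.cons x.2 (fun i => some (Quotient.mk x.1 i)) : Fin (n+1) → Option (Quotient x.1))

theorem stmt7Ext_ss {n : ℕ} (x : Σ r : Setoid (Fin n), Option (Quotient r)) (i j : Fin n) :
    (stmt7Ext x) i.succ j.succ ↔ x.1 i j := by
  unfold stmt7Ext
  rw [Setoid.ker_def, Fin.cons_succ, Fin.cons_succ, Option.some.injEq]
  exact Quotient.eq

theorem stmt7Ext_zs {n : ℕ} (x : Σ r : Setoid (Fin n), Option (Quotient r)) (j : Fin n) :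
    (stmt7Ext x) 0 j.succ ↔ x.2 = some (Quotient.mk x.1 j) := by
  unfold stmt7Ext
  rw [Setoid.ker_def, Fin.cons_succ, Fin.cons_zero]

theorem stmt7Ext_bij (n : ℕ) : Function.Bijective (stmt7Ext (n := n)) := by
  constructor
  · rintro ⟨r, c⟩ ⟨r', c'⟩ h
    have h1 : r = r' := by
      ext i j
      rw [← stmt7Ext_ss ⟨r, c⟩, h, stmt7Ext_ss]
    subst h1
    have h2 : ∀ j, c = some (Quotient.mk r j) ↔ c' = some (Quotient.mk r j) := by
      intro j
      have := stmt7Ext_zs ⟨r, c⟩ j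
      rw [h, stmt7Ext_zs] at this
      exact this.symm
    have : c = c' := by
      rcases c with _ | q
      · rcases c' with _ | q
        · rfl
        · induction q using Quotient.inductionOn with | _ a => exact (h2 a).2 rfl
      · induction q using Quotient.inductionOn with | _ a => exact ((h2 a).1 rfl).symm
    rw [this]
  · intro R
    classical
    let r : Setoid (Fin n) := Setoid.comap Fin.succ R
    let c : Option (Quotient r) :=
      if h : ∃ a : Fin n, R 0 a.succ then some (Quotient.mk r h.choose) else none
    have hc : ∀ j : Fin n, c = some (Quotient.mk r j) ↔ R 0 j.succ := by
      intro j
      by_cases h : ∃ a : Fin n, R 0 a.succ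
      · have hs := h.choose_spec
        simp only [c, dif_pos h, Option.some.injEq]
        rw [Quotient.eq]
        change R (h.choose.succ) j.succ ↔ _
        exact ⟨fun k => R.trans' hs k, fun k => R.trans' (R.symm' hs) k⟩
      · simp only [c, dif_neg h]
        simp only [reduceCtorEq, false_iff]
        exact fun k => h ⟨j, k⟩
    refine ⟨⟨r, c⟩, ?_⟩
    ext i j
    refine Fin.cases ?_ (fun i => ?_) i <;> refine Fin.cases ?_ (fun j => ?_) j
    · exact ⟨fun _ => R.refl' _, fun _ => Setoid.refl' _ _⟩
    · rw [stmt7Ext_zs]; exact hc j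
    · rw [Setoid.comm', stmt7Ext_zs, Setoid.comm' R]; exact hc i
    · rw [stmt7Ext_ss]; rfl

theorem stmt7Ext_card_none {n : ℕ} (r : Setoid (Fin n)) :
    Nat.card (Quotient (stmt7Ext ⟨r, none⟩)) = Nat.card (Quotient r) + 1 := by
  rw [← Finite.card_option, stmt7Ext, Nat.card_congr (Setoid.quotientKerEquivRange _),
    ← Nat.card_congr (Equiv.Set.univ (Option (Quotient r)))]
  congr 2
  rw [Set.range_eq_univ]
  rintro (_ | q)
  · exact ⟨0, rfl⟩
  · induction q using Quotient.inductionOn with | _ a => exact ⟨a.succ, rfl⟩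

theorem stmt7Ext_card_some {n : ℕ} (r : Setoid (Fin n)) (q : Quotient r) :
    Nat.card (Quotient (stmt7Ext ⟨r, some q⟩)) = Nat.card (Quotient r) := by
  rw [stmt7Ext, Nat.card_congr (Setoid.quotientKerEquivRange _),
    Nat.card_congr (Equiv.ofInjective (some : Quotient r → _) (Option.some_injective _))]
  congr 2
  ext o
  constructor
  · rintro ⟨i, rfl⟩
    refine Fin.cases ?_ (fun i => ?_) i
    · exact ⟨q, rfl⟩
    · exact ⟨_, rfl⟩
  · rintro ⟨q, rfl⟩
    induction q using Quotient.inductionOn with | _ a => exact ⟨a.succ, rfl⟩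

theorem stmt7_finite (n : ℕ) : Finite (Setoid (Fin n)) :=
  Finite.of_injective (fun r : Setoid (Fin n) => (r : Fin n → Fin n → Prop))
    (fun r s h => by ext i j; exact iff_of_eq (congrFun (congrFun h i) j))

noncomputable def stmt7S (n k : ℕ) : ℕ :=
  Nat.card {r : Setoid (Fin n) // Nat.card (Quotient r) = k}

theorem stmt7S_succ (n k : ℕ) :
    stmt7S (n+1) (k+1) = (k+1) * stmt7S n (k+1) + stmt7S n k := by
  classical
  have := stmt7_finite n
  have := stmt7_finite (n+1)
  have := Fintype.ofFinite (Setoid (Fin n))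
  have := Fintype.ofFinite (Setoid (Fin (n+1)))
  have key : ∀ m l [Fintype (Setoid (Fin m))], stmt7S m l =
      ∑ r : Setoid (Fin m), if Nat.card (Quotient r) = l then 1 else 0 := by
    intro m l _
    rw [stmt7S, Nat.card_eq_fintype_card, Fintype.card_subtype, Finset.card_filter]
  have hF : ∀ r : Setoid (Fin n), Fintype (Quotient r) := fun r => Fintype.ofFinite _
  rw [key, key, key, ← (Equiv.ofBijective _ (stmt7Ext_bij n)).sum_comp, Fintype.sum_sigma,
    Finset.mul_sum, ← Finset.sum_add_distrib]
  refine Finset.sum_congr rfl fun r _ => ?_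
  rw [Fintype.sum_option]
  simp only [Equiv.ofBijective_apply, stmt7Ext_card_none, stmt7Ext_card_some]
  simp only [Finset.sum_const, Finset.card_univ, ← Nat.card_eq_fintype_card, Nat.add_right_cancel_iff, smul_eq_mul]
  by_cases h : Nat.card (Quotient r) = k + 1
  · simp only [h, if_true]; ring
  · simp only [h, if_false]; ring

theorem stmt7S_succ_zero (n : ℕ) : stmt7S (n+1) 0 = 0 := by
  rw [stmt7S]
  have : IsEmpty {r : Setoid (Fin (n+1)) // Nat.card (Quotient r) = 0} := by
    constructor
    rintro ⟨r, h⟩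
    have : Nonempty (Quotient r) := ⟨Quotient.mk r 0⟩
    exact Nat.card_pos.ne' h
  exact Nat.card_of_isEmpty

theorem stmt7S_zero (k : ℕ) : stmt7S 0 k = if k = 0 then 1 else 0 := by
  rw [stmt7S]
  have hs : Subsingleton (Setoid (Fin 0)) := ⟨fun a b => by ext i; exact i.elim0⟩
  have hq : ∀ r : Setoid (Fin 0), Nat.card (Quotient r) = 0 := by
    intro r
    have : IsEmpty (Quotient r) := ⟨fun q => by
      induction q using Quotient.inductionOn with | _ a => exact a.elim0⟩
    exact Nat.card_of_isEmpty
  split_ifs with h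
  · subst h
    rw [Nat.card_eq_one_iff_unique]
    exact ⟨inferInstance, ⟨⟨⊥, hq _⟩⟩⟩
  · have : IsEmpty {r : Setoid (Fin 0) // Nat.card (Quotient r) = k} :=
      ⟨fun r => h (r.2.symm.trans (hq _))⟩
    exact Nat.card_of_isEmpty

theorem stmt7S_eq (n k : ℕ) : stmt7S n k = Nat.stirlingSecond n k := by
  induction n generalizing k with
  | zero => rw [stmt7S_zero]; cases k <;> simp
  | succ n ih =>
    cases k with
    | zero => rw [stmt7S_succ_zero]; simp
    | succ k => rw [stmt7S_succ, ih, ih, Nat.stirlingSecond_succ_succ]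

theorem stmt7_part_range {n : ℕ} (P : Finpartition (Finset.univ : Finset (Fin n))) :
    Set.range P.part = (P.parts : Set (Finset (Fin n))) := by
  ext p
  constructor
  · rintro ⟨a, rfl⟩
    exact P.part_mem.2 (Finset.mem_univ a)
  · intro hp
    obtain ⟨a, _, ha⟩ := P.part_surjOn hp
    exact ⟨a, ha⟩

theorem stirling_eq (n k : ℕ) : stirling n k = Nat.stirlingSecond n k := by
  classical
  rw [← stmt7S_eq, stirling, stmt7S]
  have hb : Function.Bijective
      (fun P : Finpartition (Finset.univ : Finset (Fin n)) => Setoid.ker P.part) := by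
    constructor
    · intro P Q h
      have h' : ∀ a b, P.part a = P.part b ↔ Q.part a = Q.part b := fun a b => by
        have : (Setoid.ker P.part) a b ↔ (Setoid.ker Q.part) a b := by
          simp only at h; rw [h]
        exact this
      have hm : ∀ (R : Finpartition (Finset.univ : Finset (Fin n))) a b,
          b ∈ R.part a ↔ R.part b = R.part a := by
        intro R a b
        constructor
        · intro hb
          exact R.part_eq_of_mem (R.part_mem.2 (Finset.mem_univ a)) hb
        · intro hb
          rw [← hb]
          exact R.mem_part (Finset.mem_univ b)
      have hp : P.part = Q.part := by
        funext a
        ext b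
        rw [hm, hm, h']
      apply Finpartition.ext
      have := stmt7_part_range P
      rw [hp, stmt7_part_range] at this
      exact_mod_cast this.symm
    · intro r
      refine ⟨Finpartition.ofSetoid r, ?_⟩
      ext a b
      simp only [Setoid.ker_def]
      rw [← Finpartition.mem_part_ofSetoid_iff_rel (s := r)]
      constructor
      · intro h
        rw [h]
        exact Finpartition.mem_part _ (Finset.mem_univ b)
      · intro hb
        exact ((Finpartition.ofSetoid r).part_eq_of_mem
          ((Finpartition.ofSetoid r).part_mem.2 (Finset.mem_univ a)) hb).symm
  refine Nat.card_congr ((Equiv.ofBijective _ hb).subtypeEquiv ?_)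
  intro P
  simp only [Equiv.ofBijective_apply]
  rw [Nat.card_congr (Setoid.quotientKerEquivRange _), stmt7_part_range]
  simp

def stmt7W : ℕ → ℕ → Finset (List ℕ)
  | 0, 0 => {[]}
  | 0, _ + 1 => ∅
  | _ + 1, 0 => ∅
  | n + 1, k + 1 =>
    (stmt7W n (k + 1) ×ˢ Finset.Icc 1 (k+1)).image (fun p => p.1 ++ [p.2]) ∪
      (stmt7W n k).image (fun w => w ++ [k+1])

theorem stmt7_foldr (w : List ℕ) (x : ℕ) :
    (w ++ [x]).foldr max 0 = max (w.foldr max 0) x := by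
  induction w with
  | nil => simp
  | cons a w ih => simp only [List.cons_append, List.foldr_cons, ih, max_assoc]

theorem stmt7_canon (w : List ℕ) (x : ℕ) :
    IsCanonicalWord (w ++ [x]) ↔ IsCanonicalWord w ∧ 0 < x ∧ x ≤ 1 + w.foldr max 0 := by
  have hlt : ∀ i, i < w.length → (w ++ [x]).getD i 0 = w.getD i 0 := fun i hi => by
    rw [List.getD_append _ _ _ _ hi]
  have heq : (w ++ [x]).getD w.length 0 = x := by simp
  unfold IsCanonicalWord
  constructor
  · rintro ⟨h1, h2, h3⟩
    refine ⟨⟨fun y hy => h1 y (by simp [hy]), fun hw => ?_, fun i hi => ?_⟩, h1 x (by simp), ?_⟩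
    · have := h2 (by simp)
      rwa [hlt 0 (List.length_pos_iff.2 hw)] at this
    · have := h3 i (by simp; omega)
      rwa [hlt _ hi, List.take_append_of_le_length (by omega)] at this
    · rcases Nat.eq_zero_or_pos w.length with h | h
      · have hw : w = [] := List.length_eq_zero_iff.1 h
        subst hw
        have := h2 (by simp)
        simp at this
        simp [this]
      · have := h3 (w.length - 1) (by simp; omega)
        rw [Nat.sub_add_cancel h, heq, List.take_append_of_le_length le_rfl,
          List.take_length] at this
        exact this
  · rintro ⟨⟨h1, h2, h3⟩, h4, h5⟩
    refine ⟨fun y hy => ?_, fun _ => ?_, fun i hi => ?_⟩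
    · rcases List.mem_append.1 hy with h | h
      · exact h1 y h
      · rw [List.mem_singleton.1 h]; exact h4
    · rcases Nat.eq_zero_or_pos w.length with h | h
      · have hw : w = [] := List.length_eq_zero_iff.1 h
        subst hw
        simp at h5 ⊢
        omega
      · rw [hlt 0 h]; exact h2 (List.length_pos_iff.1 h)
    · simp only [List.length_append, List.length_singleton] at hi
      rw [List.take_append_of_le_length (by omega)]
      rcases Nat.lt_or_ge (i+1) w.length with h | h
      · rw [hlt _ h]; exact h3 i h
      · have : i + 1 = w.length := by omega
        rw [this, heq, List.take_length]; exact h5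

theorem stmt7W_mem (n k : ℕ) (w : List ℕ) :
    w ∈ stmt7W n k ↔ IsCanonicalWord w ∧ w.length = n ∧ w.foldr max 0 = k := by
  induction n generalizing k w with
  | zero =>
    cases k with
    | zero =>
      simp only [stmt7W, Finset.mem_singleton]
      constructor
      · rintro rfl; simp [IsCanonicalWord]
      · rintro ⟨_, h, _⟩; exact List.length_eq_zero_iff.1 h
    | succ k =>
      simp only [stmt7W, Finset.notMem_empty, false_iff]
      rintro ⟨_, h, h'⟩
      rw [List.length_eq_zero_iff.1 h] at h'
      simp at h'
  | succ n ih =>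
    rcases List.eq_nil_or_concat w with rfl | ⟨v, x, rfl⟩
    · cases k <;> simp [stmt7W]
    · rw [List.concat_eq_append, stmt7_canon, stmt7_foldr]
      cases k with
      | zero =>
        simp only [stmt7W, Finset.notMem_empty, false_iff]
        rintro ⟨⟨_, h, _⟩, _, h'⟩
        omega
      | succ k =>
        simp only [stmt7W, Finset.mem_union, Finset.mem_image, Finset.mem_product, ih,
          Finset.mem_Icc, Prod.exists, List.length_append, List.length_singleton]
        constructor
        · rintro (⟨u, y, ⟨⟨h1, h2, h3⟩, h4⟩, h⟩ | ⟨u, ⟨h1, h2, h3⟩, h⟩)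
          · obtain ⟨rfl, h⟩ := List.append_inj' h rfl
            obtain rfl : y = x := by simpa using h
            exact ⟨⟨h1, by omega, by omega⟩, by omega, by omega⟩
          · obtain ⟨rfl, h⟩ := List.append_inj' h rfl
            obtain rfl : k + 1 = x := by simpa using h
            exact ⟨⟨h1, by omega, by omega⟩, by omega, by omega⟩
        · rintro ⟨⟨h1, h2, h3⟩, h4, h5⟩
          by_cases h : v.foldr max 0 = k + 1
          · exact Or.inl ⟨v, x, ⟨⟨h1, by omega, h⟩, by omega⟩, rfl⟩
          · obtain rfl : x = k + 1 := by omega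
            exact Or.inr ⟨v, ⟨h1, by omega, by omega⟩, rfl⟩

theorem stmt7W_sum (n k : ℕ) (F : List ℕ → ℚ) :
    ∑ w ∈ stmt7W (n+1) (k+1), F w =
      ∑ w ∈ stmt7W n (k+1), ∑ x ∈ Finset.Icc 1 (k+1), F (w ++ [x]) +
        ∑ w ∈ stmt7W n k, F (w ++ [k+1]) := by
  rw [stmt7W, Finset.sum_union, Finset.sum_image, Finset.sum_image, Finset.sum_product]
  · intro a _ b _ h
    exact List.append_cancel_right h
  · rintro ⟨a, x⟩ _ ⟨b, y⟩ _ h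
    obtain ⟨h1, h2⟩ := List.append_inj' h rfl
    simp at h1 h2
    simp [h1, h2]
  · rw [Finset.disjoint_left]
    intro w h1 h2
    simp only [Finset.mem_image, Finset.mem_product, stmt7W_mem, Prod.exists] at h1 h2
    obtain ⟨a, x, ⟨⟨_, _, h⟩, _⟩, rfl⟩ := h1
    obtain ⟨b, ⟨_, _, h'⟩, h2⟩ := h2
    obtain ⟨rfl, _⟩ := List.append_inj' h2 rfl
    omega

theorem stmt7W_card (n k : ℕ) : ((stmt7W n k).card : ℚ) = Nat.stirlingSecond n k := by
  induction n generalizing k with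
  | zero => cases k <;> simp [stmt7W]
  | succ n ih =>
    cases k with
    | zero => simp [stmt7W]
    | succ k =>
      have := stmt7W_sum n k (fun _ => 1)
      simp only [Finset.sum_const, nsmul_eq_mul, mul_one, Nat.card_Icc, ih] at this
      rw [this, Nat.stirlingSecond_succ_succ]
      push_cast
      ring_nf

theorem stmt7_sumIcc (k : ℕ) : ∑ x ∈ Finset.Icc 1 k, (x : ℚ) = k * (k+1) / 2 := by
  induction k with
  | zero => simp
  | succ k ih => rw [Finset.sum_Icc_succ_top (by omega), ih]; push_cast; ring

theorem stmt7W_last (n k : ℕ) : ∑ w ∈ stmt7W (n+1) (k+1), ((w.getLastD 0 : ℕ) : ℚ) =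
    (k+1) * (k+2) / 2 * Nat.stirlingSecond n (k+1) + (k+1) * Nat.stirlingSecond n k := by
  rw [stmt7W_sum]
  simp only [List.getLastD_concat, stmt7_sumIcc, Finset.sum_const, nsmul_eq_mul, stmt7W_card]
  push_cast
  ring

theorem stmt7_corner (w : List ℕ) (x : ℕ) :
    cornerA (w ++ [x]) = cornerA w + if x < w.getLastD 0 then 1 else 0 := by
  rcases List.eq_nil_or_concat w with rfl | ⟨v, y, rfl⟩
  · simp [cornerA]
  · simp only [List.concat_eq_append, List.getLastD_concat]
    unfold cornerA
    simp only [List.length_append, List.length_singleton, Nat.add_sub_cancel]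
    rw [Finset.range_add_one, Finset.filter_insert]
    have e1 : (v ++ [y] ++ [x]).getD (v.length + 1) 0 = x := by simp
    have e2 : (v ++ [y] ++ [x]).getD v.length 0 = y := by simp
    rw [e1, e2]
    have e3 : Finset.filter (fun i => (v ++ [y] ++ [x]).getD (i+1) 0 < (v ++ [y] ++ [x]).getD i 0)
        (Finset.range v.length) =
        Finset.filter (fun i => (v ++ [y]).getD (i+1) 0 < (v ++ [y]).getD i 0)
        (Finset.range v.length) := by
      apply Finset.filter_congr
      intro i hi
      rw [Finset.mem_range] at hi
      rw [List.getD_append (v ++ [y]) [x] 0 (i+1) (by simp; omega),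
        List.getD_append (v ++ [y]) [x] 0 i (by simp; omega)]
    rw [e3]
    split_ifs with h
    · rw [Finset.card_insert_of_notMem (by simp)]
    · rfl

theorem stmt7_le (w : List ℕ) : w.getLastD 0 ≤ w.foldr max 0 := by
  rcases List.eq_nil_or_concat w with rfl | ⟨v, y, rfl⟩
  · simp
  · rw [List.concat_eq_append, stmt7_foldr, List.getLastD_concat]; omega

theorem stmt7_pos (w : List ℕ) (h : IsCanonicalWord w) (h' : w ≠ []) : 1 ≤ w.getLastD 0 := by
  rcases List.eq_nil_or_concat w with rfl | ⟨v, y, rfl⟩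
  · exact absurd rfl h'
  · rw [List.concat_eq_append] at h ⊢
    rw [List.getLastD_concat]; exact h.1 y (by simp)

noncomputable def stmt7A (n k : ℕ) : ℚ := ∑ w ∈ stmt7W n k, (cornerA w : ℚ)

theorem stmt7A_rec (n k : ℕ) : stmt7A (n+2) (k+1) = (k+1) * stmt7A (n+1) (k+1) + stmt7A (n+1) k
    + (k+1) * k / 2 * Nat.stirlingSecond n (k+1) + k * Nat.stirlingSecond n k := by
  have h1 : ∀ w ∈ stmt7W (n+1) (k+1), ∑ x ∈ Finset.Icc 1 (k+1), (cornerA (w ++ [x]) : ℚ) =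
      (k+1) * cornerA w + (((w.getLastD 0 : ℕ) : ℚ) - 1) := by
    intro w hw
    rw [stmt7W_mem] at hw
    have hp := stmt7_pos w hw.1 (by rintro rfl; simp at hw)
    have hl := stmt7_le w
    rw [hw.2.2] at hl
    simp only [stmt7_corner, Nat.cast_add, Finset.sum_add_distrib, Finset.sum_const, nsmul_eq_mul,
      Nat.card_Icc]
    congr 1
    · push_cast; ring
    · rw [← Nat.cast_sum, ← Finset.card_filter]
      have : Finset.filter (fun x => x < w.getLastD 0) (Finset.Icc 1 (k+1)) =
          Finset.Ico 1 (w.getLastD 0) := by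
        ext x; simp only [Finset.mem_filter, Finset.mem_Icc, Finset.mem_Ico]; omega
      rw [this, Nat.card_Ico, Nat.cast_sub hp]; simp
  have h2 : ∀ w ∈ stmt7W (n+1) k, (cornerA (w ++ [k+1]) : ℚ) = cornerA w := by
    intro w hw
    rw [stmt7W_mem] at hw
    have hl := stmt7_le w
    rw [stmt7_corner, if_neg (by omega)]; simp
  unfold stmt7A
  rw [stmt7W_sum, Finset.sum_congr rfl h1, Finset.sum_congr rfl h2, Finset.sum_add_distrib,
    Finset.sum_sub_distrib, stmt7W_last, ← Finset.mul_sum]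
  simp only [Finset.sum_const, nsmul_eq_mul, mul_one, stmt7W_card, Nat.stirlingSecond_succ_succ]
  push_cast
  ring

noncomputable def stmt7T (n k : ℕ) : ℚ := if 2 ≤ k then (Nat.stirlingSecond n (k-2) : ℚ) else 0

theorem stmt7A_one (k : ℕ) : stmt7A 1 k = 0 := by
  unfold stmt7A
  apply Finset.sum_eq_zero
  intro w hw
  rw [stmt7W_mem] at hw
  simp [cornerA, hw.2.1]

theorem stmt7A_zero (n : ℕ) : stmt7A (n+1) 0 = 0 := by
  simp [stmt7A, stmt7W]

theorem stmt7A_closed (n k : ℕ) : stmt7A (n+1) k =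
    ((n : ℚ) / 2) * Nat.stirlingSecond (n + 1) k - (1 / 4) * Nat.stirlingSecond (n + 2) k -
        ((n : ℚ) / 2) * Nat.stirlingSecond n k + (1 / 4) * Nat.stirlingSecond (n + 1) k +
        (1 / 4) * stmt7T n k := by
  induction n generalizing k with
  | zero =>
    rw [stmt7A_one]
    rcases k with _ | _ | _ | k <;> simp [stmt7T, Nat.stirlingSecond]
  | succ n ih =>
    rcases k with _ | _ | k
    · rw [stmt7A_zero]; simp [stmt7T]
    · have h0 : (n : ℚ) * Nat.stirlingSecond n 0 = 0 := by cases n <;> simp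
      rw [stmt7A_rec, ih, stmt7A_zero]
      simp [stmt7T, Nat.stirlingSecond_succ_succ]
      linear_combination (1/2) * h0
    · rw [stmt7A_rec, ih, ih]
      rcases k with _ | k
      · simp [stmt7T, Nat.stirlingSecond_succ_succ]
        ring
      · simp [stmt7T, Nat.stirlingSecond_succ_succ]
        ring

/-- The total number of corners of type A over all set partitions of `[n+1]` with exactly
`k` blocks equals `(n/2)S(n+1,k) − (1/4)S(n+2,k) − (n/2)S(n,k) + (1/4)S(n+1,k) + (1/4)S(n,k−2)`
(where `S(n, k-2) = 0` when `k < 2`). -/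
theorem stmt7 (n k : ℕ) (hk : 1 ≤ k) :
    ((∑ᶠ w : {w : List ℕ //
        IsCanonicalWord w ∧ w.length = n + 1 ∧ w.foldr max 0 = k}, cornerA w.1 : ℕ) : ℚ) =
      ((n : ℚ) / 2) * stirling (n + 1) k - (1 / 4) * stirling (n + 2) k -
        ((n : ℚ) / 2) * stirling n k + (1 / 4) * stirling (n + 1) k +
        (if 2 ≤ k then (1 / 4) * (stirling n (k - 2) : ℚ) else 0) := by
  have h : (∑ᶠ w : {w : List ℕ //
        IsCanonicalWord w ∧ w.length = n + 1 ∧ w.foldr max 0 = k}, cornerA w.1 : ℕ) =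
      ∑ w ∈ stmt7W (n+1) k, cornerA w := by
    rw [← finsum_mem_coe_finset]
    have e : {w : List ℕ | IsCanonicalWord w ∧ w.length = n + 1 ∧ w.foldr max 0 = k} =
        (stmt7W (n+1) k : Set (List ℕ)) := by
      ext w
      rw [Finset.mem_coe, stmt7W_mem]; rfl
    rw [← e]
    exact finsum_set_coe_eq_finsum_mem
      {w : List ℕ | IsCanonicalWord w ∧ w.length = n + 1 ∧ w.foldr max 0 = k}
  have h2 := stmt7A_closed n k
  rw [h]
  simp only [stirling_eq]
  rw [stmt7A] at h2
  push_cast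
  rw [h2, stmt7T]
  split_ifs <;> ring
end
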